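/- Let m ≥ 2, let q ≥ 2 be an integer, and let Ω be a nonempty closed subset of Σ_m. Then the Minkowski dimension of X_Ω exists, i.e. the limit lim_{n→∞} log_m N_n(X_Ω)/n exists, and it equals (q-1)² · Σ_{k=1}^∞ log_m |Pref_k(Ω)| / q^{k+1}. -/

import Mathlib

open scoped Classical ENNReal
open Filter MeasureTheory Topology

noncomputable section

/-- `Begins x u` : the finite word `u` is a prefix of the sequence `x` (indexed by `ℕ+`). -/
def Begins {m : ℕ} (x : ℕ+ → Fin m) (u : List (Fin m)) : Prop :=
  ∀ j : Fin u.length, x ⟨(j : ℕ) + 1, Nat.succ_pos _⟩ = u.get j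

/-- `Cyl u` : the cylinder set of the word `u`. -/
def Cyl {m : ℕ} (u : List (Fin m)) : Set (ℕ+ → Fin m) := {x | Begins x u}

/-- `Pref Ω` : the set of (finite) prefixes of sequences in `Ω`. -/
def Pref {m : ℕ} (Ω : Set (ℕ+ → Fin m)) : Set (List (Fin m)) := {u | ∃ x ∈ Ω, Begins x u}

/-- number of length-`n` words beginning some sequence of `X`. -/
def NWords {m : ℕ} (n : ℕ) (X : Set (ℕ+ → Fin m)) : ℕ :=
  Set.ncard {u : List (Fin m) | u.length = n ∧ u ∈ Pref X}

/-- restriction of `x` to the geometric progression `J_i = {i, qi, q²i, …}`: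
`(x|J_i)_k = x_{q^{k-1} i}` for `k ≥ 1`. -/
def RestrJ {m : ℕ} (q : ℕ+) (x : ℕ+ → Fin m) (i : ℕ+) : ℕ+ → Fin m :=
  fun k => x (q ^ ((k : ℕ) - 1) * i)

/-- the multiplicative subshift `X_Ω = {x : x|J_i ∈ Ω for all i with q ∤ i}`. -/
def XOm {m : ℕ} (q : ℕ+) (Ω : Set (ℕ+ → Fin m)) : Set (ℕ+ → Fin m) :=
  {x | ∀ i : ℕ+, ¬ q ∣ i → RestrJ q x i ∈ Ω}

/-- the real number `Σ_{k≥1} x_k m^{-k}` with base-`m` digit sequence `x`. -/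
def ValMap (m : ℕ) (x : ℕ+ → Fin m) : ℝ := ∑' k : ℕ+, ((x k : ℕ) : ℝ) * (m : ℝ)⁻¹ ^ (k : ℕ)

/-- the subset of `[0,1]` of reals whose base-`m` digit sequence lies in `X`. -/
def XiSet {m : ℕ} (X : Set (ℕ+ → Fin m)) : Set ℝ := {r | ∃ x ∈ X, r = ValMap m x}

/-- entropy (base-`m` logarithms) of the partition of `Ω` into `k`-cylinders, for a measure
supported on `Ω` (words that are not prefixes of `Ω` get measure `0` and contribute nothing). -/
def Hent (m : ℕ) (μ : Measure (ℕ+ → Fin m)) (k : ℕ) : ℝ :=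
  -∑ u : Fin k → Fin m,
    ((μ (Cyl (List.ofFn u))).toReal * Real.logb m (μ (Cyl (List.ofFn u))).toReal)

/-- `s(Ω,μ) = (q-1)² Σ_{k≥1} H_m^μ(α_k)/q^{k+1}`. -/
def sOm (m : ℕ) (q : ℕ+) (μ : Measure (ℕ+ → Fin m)) : ℝ :=
  ((q : ℝ) - 1) ^ 2 * ∑' k : ℕ, Hent m μ (k + 1) / (q : ℝ) ^ (k + 2)

/-- cylinder determined by the first `n` entries of `x`, i.e. `[x₁…x_n]`. -/
def CylN {m : ℕ} (n : ℕ) (x : ℕ+ → Fin m) : Set (ℕ+ → Fin m) :=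
  {y | ∀ k : ℕ+, (k : ℕ) ≤ n → y k = x k}

/-- the cylinder `[u|J_i]` where `u = x₁…x_n`: sequences `y` with
`y_{ℓ+1} = x_{q^ℓ i}` for all `ℓ ≥ 0` with `q^ℓ i ≤ n`. -/
def CylJ {m : ℕ} (q n i : ℕ+) (x : ℕ+ → Fin m) : Set (ℕ+ → Fin m) :=
  {y | ∀ ℓ : ℕ, q ^ ℓ * i ≤ n → y ⟨ℓ + 1, Nat.succ_pos _⟩ = x (q ^ ℓ * i)}

/-- `P` has the product structure `P[u] = ∏_{i ≤ |u|, q ∤ i} μ[u|J_i]` on cylinders. -/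
def ProdProp {m : ℕ} (q : ℕ+) (μ P : Measure (ℕ+ → Fin m)) : Prop :=
  ∀ (n : ℕ+) (x : ℕ+ → Fin m),
    P (CylN (n : ℕ) x) = ∏ i ∈ (Finset.Icc 1 n).filter (fun i => ¬ q ∣ i), μ (CylJ q n i x)

/-- `t` is a `[1, m^{1/(q-1)}]`-valued solution of `t(u)^q = Σ_{j : uj ∈ Pref(Ω)} t(uj)`
on the tree of prefixes of `Ω`. -/
def TSol {m : ℕ} (q : ℕ+) (Ω : Set (ℕ+ → Fin m)) (t : List (Fin m) → ℝ) : Prop :=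
  ∀ u ∈ Pref Ω,
    t u ∈ Set.Icc 1 ((m : ℝ) ^ ((1 : ℝ) / ((q : ℝ) - 1))) ∧
    t u ^ (q : ℕ) =
      ∑ j ∈ Finset.univ.filter (fun j : Fin m => u ++ [j] ∈ Pref Ω), t (u ++ [j])

/-- `μ` has the cylinder values `μ[u₁…u_k] = ∏_{j=1}^k t(u₁…u_j)/t(u₁…u_{j-1})^q`
for prefixes `u` of `Ω`. -/
def CylVals {m : ℕ} (q : ℕ+) (Ω : Set (ℕ+ → Fin m)) (t : List (Fin m) → ℝ)
    (μ : Measure (ℕ+ → Fin m)) : Prop :=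
  ∀ u ∈ Pref Ω,
    μ (Cyl u) =
      ENNReal.ofReal (∏ j ∈ Finset.range u.length, t (u.take (j + 1)) / t (u.take j) ^ (q : ℕ))

/-- Restrictions to the first `k` coordinates of the sequences in `X`. -/
def WSet {m : ℕ} (k : ℕ) (X : Set (ℕ+ → Fin m)) : Set (Fin k → Fin m) :=
  (fun (x : ℕ+ → Fin m) (j : Fin k) => x ⟨(j : ℕ) + 1, Nat.succ_pos _⟩) '' X

theorem begins_ofFn {m k : ℕ} (x : ℕ+ → Fin m) (w : Fin k → Fin m) :
    Begins x (List.ofFn w) ↔ (fun j : Fin k => x ⟨(j : ℕ) + 1, Nat.succ_pos _⟩) = w := by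
  unfold Begins
  constructor
  · intro h
    funext j
    have := h ⟨j, by simp⟩
    simpa using this
  · rintro rfl j
    simp

theorem ncard_words {m : ℕ} (k : ℕ) (X : Set (ℕ+ → Fin m)) :
    Set.ncard {u : List (Fin m) | u.length = k ∧ u ∈ Pref X} = (WSet k X).ncard := by
  rw [← Set.ncard_image_of_injective (WSet k X) (List.ofFn_injective (n := k))]
  congr 1
  ext u
  constructor
  · rintro ⟨rfl, x, hx, hb⟩
    refine ⟨fun j => u.get j, ⟨x, hx, ?_⟩, List.ofFn_get u⟩
    funext j
    exact hb j
  · rintro ⟨w, ⟨x, hx, hw⟩, rfl⟩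
    exact ⟨by simp, x, hx, (begins_ofFn x w).2 hw⟩

theorem pow_mul_unique {q : ℕ+} {a b : ℕ} {i j : ℕ+} (hi : ¬ q ∣ i)
    (hj : ¬ q ∣ j) (h : q ^ a * i = q ^ b * j) : a = b ∧ i = j := by
  have key : ∀ {a b : ℕ} {i j : ℕ+}, ¬ q ∣ i → q ^ a * i = q ^ b * j → b ≤ a := by
    intro a b i j hi h
    by_contra! hlt
    obtain ⟨c, rfl⟩ := Nat.exists_eq_add_of_lt hlt
    rw [show a + c + 1 = a + (c + 1) by ring, pow_add, mul_assoc] at h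
    have h2 := mul_left_cancel h
    exact hi ⟨q ^ c * j, by rw [h2, pow_succ']; rw [mul_assoc]⟩
  have hab : a = b := le_antisymm (key hj h.symm) (key hi h)
  subst hab
  exact ⟨rfl, mul_left_cancel h⟩

theorem exists_decomp {q : ℕ+} (hq : 2 ≤ (q : ℕ)) (j : ℕ+) :
    ∃ p : ℕ × ℕ+, j = q ^ p.1 * p.2 ∧ ¬ q ∣ p.2 := by
  obtain ⟨e, n', h1, h2⟩ := Nat.exists_eq_pow_mul_and_not_dvd (n := (j : ℕ)) j.pos.ne' (q : ℕ)
    (by omega)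
  have hn : 0 < n' := by
    rcases Nat.eq_zero_or_pos n' with h | h
    · subst h; simp at h1
    · exact h
  refine ⟨(e, ⟨n', hn⟩), ?_, ?_⟩
  · apply PNat.eq
    rw [PNat.mul_coe, PNat.pow_coe]
    exact h2
  · rw [PNat.dvd_iff]
    exact h1

theorem exists_glue {m : ℕ} {q : ℕ+} (hq : 2 ≤ (q : ℕ)) (Y : ℕ+ → ℕ+ → Fin m) :
    ∃ x : ℕ+ → Fin m, ∀ i, ¬ q ∣ i → RestrJ q x i = Y i := by
  choose p hp hp' using exists_decomp hq
  refine ⟨fun j => Y (p j).2 ⟨(p j).1 + 1, Nat.succ_pos _⟩, fun i hi => ?_⟩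
  funext k
  unfold RestrJ
  obtain ⟨h1, h2⟩ := pow_mul_unique hi (hp' _) (hp (q ^ ((k : ℕ) - 1) * i))
  simp only
  rw [← h2]
  congr 1
  apply PNat.eq
  simp only [PNat.mk_coe]
  rw [← h1]
  have := k.pos
  omega

/-- Indices up to `n` that are not divisible by `q`. -/
def IdxSet (q n : ℕ) : Finset ℕ := (Finset.Ioc 0 n).filter (fun i => ¬ q ∣ i)

theorem len_iff {q n i l : ℕ} (hq : 2 ≤ q) (hi : 0 < i) (hin : i ≤ n) :
    l < Nat.log q (n / i) + 1 ↔ q ^ l * i ≤ n := by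
  rw [Nat.lt_succ_iff, Nat.le_log_iff_pow_le (by omega) (Nat.div_pos hin hi).ne',
    Nat.le_div_iff_mul_le hi]

theorem pnat_aux (q : ℕ+) (l i : ℕ) (hi : 0 < i) :
    q ^ (l + 1 - 1) * (show ℕ+ from ⟨i, hi⟩)
      = (show ℕ+ from ⟨(q : ℕ) ^ l * i - 1 + 1, Nat.succ_pos _⟩) := by
  have h : 0 < (q : ℕ) ^ l * i := Nat.mul_pos (pow_pos q.pos _) hi
  apply PNat.eq
  rw [PNat.mul_coe, PNat.pow_coe, Nat.add_sub_cancel]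
  change (q : ℕ) ^ l * i = (q : ℕ) ^ l * i - 1 + 1
  omega

theorem card_prod {m : ℕ} {q : ℕ+} (hq : 2 ≤ (q : ℕ)) (Ω : Set (ℕ+ → Fin m))
    (hne : Ω.Nonempty) (n : ℕ) :
    (WSet n (XOm q Ω)).ncard
      = ∏ i ∈ IdxSet q n, (WSet (Nat.log q (n / i) + 1) Ω).ncard := by
  have hI : ∀ i : IdxSet q n, 0 < (i : ℕ) ∧ (i : ℕ) ≤ n ∧ ¬ (q : ℕ) ∣ i := by
    rintro ⟨i, hi⟩
    simp only [IdxSet, Finset.mem_filter, Finset.mem_Ioc] at hi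
    exact ⟨hi.1.1, hi.1.2, hi.2⟩
  have hl : ∀ (i : IdxSet q n) (l : Fin (Nat.log q (n / i) + 1)), (q : ℕ) ^ (l : ℕ) * i ≤ n :=
    fun i l => (len_iff hq (hI i).1 (hI i).2.1).1 l.2
  have hpos : ∀ (i : IdxSet q n) (l : ℕ), 0 < (q : ℕ) ^ l * i :=
    fun i l => Nat.mul_pos (pow_pos q.pos _) (hI i).1
  let F : (Fin n → Fin m) → ((i : IdxSet q n) → Fin (Nat.log q (n / i) + 1) → Fin m) :=
    fun w i l => w ⟨(q : ℕ) ^ (l : ℕ) * i - 1, by have := hl i l; have := hpos i l; omega⟩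
  have hF : Function.Injective F := by
    intro w w' h
    funext j
    obtain ⟨⟨l, i⟩, h1, h2⟩ := exists_decomp hq ⟨(j : ℕ) + 1, Nat.succ_pos _⟩
    have h1' : (j : ℕ) + 1 = (q : ℕ) ^ l * i := by
      simpa using congrArg PNat.val h1
    have hle : (q : ℕ) ^ l * i ≤ n := by have := j.2; omega
    have hin : (i : ℕ) ≤ n :=
      le_trans (Nat.le_mul_of_pos_left _ (pow_pos q.pos _)) hle
    have hmem : (i : ℕ) ∈ IdxSet q n := by
      simp only [IdxSet, Finset.mem_filter, Finset.mem_Ioc]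
      exact ⟨⟨i.pos, hin⟩, fun hd => h2 (PNat.dvd_iff.2 hd)⟩
    have := congrFun (congrFun h ⟨i, hmem⟩) ⟨l, (len_iff hq i.pos hin).2 hle⟩
    have e : j = ⟨(q : ℕ) ^ l * i - 1, by have := j.2; omega⟩ := by
      apply Fin.ext; simp only; omega
    rw [e]
    exact this
  have himg : F '' (WSet n (XOm q Ω))
      = Set.pi Set.univ (fun i : IdxSet q n => WSet (Nat.log q (n / i) + 1) Ω) := by
    ext v
    constructor
    · rintro ⟨w, ⟨x, hx, rfl⟩, rfl⟩ i -
      refine ⟨RestrJ q x ⟨i, (hI i).1⟩, hx _ (fun hd => (hI i).2.2 (PNat.dvd_iff.1 hd)), ?_⟩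
      funext l
      exact congrArg x (pnat_aux q l i (hI i).1)
    · intro hv
      choose y hy hyv using fun i : IdxSet q n => hv i (Set.mem_univ i)
      obtain ⟨ω, hω⟩ := hne
      obtain ⟨x, hx⟩ := exists_glue hq
        (fun i : ℕ+ => if h : (i : ℕ) ∈ IdxSet q n then y ⟨i, h⟩ else ω)
      refine ⟨_, ⟨x, ?_, rfl⟩, ?_⟩
      · intro i hi
        rw [hx i hi]
        split_ifs with h
        · exact hy _
        · exact hω
      · funext i l
        rw [← hyv i]
        have h2 := hx ⟨i, (hI i).1⟩ (fun hd => (hI i).2.2 (PNat.dvd_iff.1 hd))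
        have h3 : (((⟨i, (hI i).1⟩ : ℕ+)) : ℕ) ∈ IdxSet q n := i.2
        replace h2 := h2.trans (dif_pos h3)
        have h4 := congrFun h2 ⟨(l : ℕ) + 1, Nat.succ_pos _⟩
        refine Eq.trans ?_ h4
        exact (congrArg x (pnat_aux q l i (hI i).1)).symm
  rw [← Set.ncard_image_of_injective _ hF, himg, ← Nat.card_coe_set_eq,
    Nat.card_congr (Equiv.Set.univPi _), Nat.card_pi]
  simp only [Nat.card_coe_set_eq]
  exact Finset.prod_coe_sort (IdxSet q n) (fun i => (WSet (Nat.log q (n / i) + 1) Ω).ncard)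

/-- Number of indices whose progression meets `[1,n]` in exactly `k+1` points. -/
def cnt (q n k : ℕ) : ℕ := ((IdxSet q n).filter (fun i => Nat.log q (n / i) = k)).card

theorem card_idx (q n : ℕ) : (IdxSet q n).card + n / q = n := by
  have h := Finset.card_filter_add_card_filter_not (s := Finset.Ioc 0 n) (fun i => q ∣ i)
  rw [Nat.Ioc_filter_dvd_card_eq_div] at h
  simp only [Nat.card_Ioc] at h
  unfold IdxSet
  omega

theorem cnt_add {q n k : ℕ} (hq : 2 ≤ q) :
    cnt q n k + (IdxSet q (n / q ^ (k + 1))).card = (IdxSet q (n / q ^ k)).card := by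
  have hqk : ∀ k, 0 < q ^ k := fun k => pow_pos (by omega) k
  have h := Finset.card_filter_add_card_filter_not (s := IdxSet q (n / q ^ k))
    (fun i => ¬ i ≤ n / q ^ (k + 1))
  rw [← h]
  unfold cnt
  congr 2
  · ext i
    simp only [IdxSet, Finset.mem_filter, Finset.mem_Ioc, not_le]
    constructor
    · rintro ⟨⟨⟨h0, h1⟩, h2⟩, rfl⟩
      refine ⟨⟨⟨h0, ?_⟩, h2⟩, ?_⟩
      · rw [Nat.le_div_iff_mul_le (hqk _), mul_comm]
        exact (len_iff hq h0 h1).1 (Nat.lt_succ_self _)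
      · rw [Nat.div_lt_iff_lt_mul (hqk _), mul_comm]
        by_contra! hc
        have := (len_iff hq h0 h1).2 hc
        omega
    · rintro ⟨⟨⟨h0, h1⟩, h2⟩, h3⟩
      have hin : i ≤ n := h1.trans (Nat.div_le_self _ _)
      refine ⟨⟨⟨h0, hin⟩, h2⟩, ?_⟩
      rw [Nat.le_div_iff_mul_le (hqk _), mul_comm] at h1
      rw [Nat.div_lt_iff_lt_mul (hqk _), mul_comm] at h3
      have a1 := (len_iff hq h0 hin).2 h1
      have a2 : ¬ k + 1 < Nat.log q (n / i) + 1 := fun hc =>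
        absurd ((len_iff hq h0 hin).1 hc) (by omega)
      omega
  · ext i
    simp only [IdxSet, Finset.mem_filter, Finset.mem_Ioc, not_not]
    have : n / q ^ (k + 1) ≤ n / q ^ k :=
      Nat.div_le_div_left (Nat.pow_le_pow_right (by omega) (by omega)) (hqk k)
    constructor
    · rintro ⟨⟨h0, h1⟩, h2⟩
      exact ⟨⟨⟨h0, h1.trans this⟩, h2⟩, h1⟩
    · rintro ⟨⟨⟨h0, h1⟩, h2⟩, h3⟩
      exact ⟨⟨h0, h3⟩, h2⟩

theorem cnt_eq {q n k : ℕ} (hq : 2 ≤ q) :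
    (cnt q n k : ℝ) = ((n / q ^ k : ℕ) : ℝ) - 2 * ((n / q ^ (k + 1) : ℕ) : ℝ)
      + ((n / q ^ (k + 2) : ℕ) : ℝ) := by
  have h1 := cnt_add (n := n) (k := k) hq
  have h2 := card_idx q (n / q ^ k)
  have h3 := card_idx q (n / q ^ (k + 1))
  rw [Nat.div_div_eq_div_mul, ← pow_succ] at h2 h3
  have h1' : (cnt q n k : ℝ) + (IdxSet q (n / q ^ (k + 1))).card
    = (IdxSet q (n / q ^ k)).card := by exact_mod_cast h1
  have h2' : ((IdxSet q (n / q ^ k)).card : ℝ) + ((n / q ^ (k + 1) : ℕ) : ℝ)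
    = ((n / q ^ k : ℕ) : ℝ) := by exact_mod_cast h2
  have h3' : ((IdxSet q (n / q ^ (k + 1))).card : ℝ) + ((n / q ^ (k + 2) : ℕ) : ℝ)
    = ((n / q ^ (k + 1) : ℕ) : ℝ) := by exact_mod_cast h3
  linarith

theorem cnt_le {q n k : ℕ} (hq : 2 ≤ q) : (cnt q n k : ℝ) ≤ n / (q : ℝ) ^ k := by
  have h1 := cnt_add (n := n) (k := k) hq
  have h2 := card_idx q (n / q ^ k)
  have h3 : cnt q n k ≤ n / q ^ k :=
    (le_of_le_of_eq (Nat.le_add_right _ _) h1).trans (le_of_le_of_eq (Nat.le_add_right _ _) h2)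
  calc (cnt q n k : ℝ) ≤ ((n / q ^ k : ℕ) : ℝ) := by exact_mod_cast h3
    _ ≤ _ := by
      have := @Nat.cast_div_le ℝ _ _ _ n (q ^ k)
      simpa using this

theorem tendsto_div (d : ℕ) :
    Tendsto (fun n : ℕ => ((n / d : ℕ) : ℝ) / n) atTop (𝓝 (1 / (d : ℝ))) := by
  have h := (tendsto_nat_floor_mul_div_atTop (R := ℝ) (a := 1 / (d : ℝ)) (by positivity)).comp
    tendsto_natCast_atTop_atTop
  refine h.congr fun n => ?_
  simp only [Function.comp]
  rw [one_div_mul_eq_div, Nat.floor_div_natCast, Nat.floor_natCast]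

theorem cnt_tendsto {q k : ℕ} (hq : 2 ≤ q) :
    Tendsto (fun n : ℕ => (cnt q n k : ℝ) / n) atTop
      (𝓝 (((q : ℝ) - 1) ^ 2 / (q : ℝ) ^ (k + 2))) := by
  have h := ((tendsto_div (q ^ k)).sub ((tendsto_div (q ^ (k + 1))).const_mul 2)).add
    (tendsto_div (q ^ (k + 2)))
  have hq0 : (q : ℝ) ≠ 0 := by positivity
  convert h using 1
  · funext n
    rw [cnt_eq hq]
    ring
  · congr 1
    push_cast
    field_simp
    ring

theorem sum_tendsto {q : ℕ} (hq : 2 ≤ q) (L : ℕ → ℝ) (hL : ∀ k, |L k| ≤ (k : ℝ) + 1) :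
    Tendsto (fun n : ℕ => (∑ i ∈ IdxSet q n, L (Nat.log q (n / i))) / n) atTop
      (𝓝 (((q : ℝ) - 1) ^ 2 * ∑' k : ℕ, L k / (q : ℝ) ^ (k + 2))) := by
  have hq0 : (0 : ℝ) < q := by positivity
  have hq1 : (1 : ℝ) < q := by exact_mod_cast (by omega : 1 < q)
  have hsum : Summable (fun k : ℕ => ((k : ℝ) + 1) * (1 / (q : ℝ)) ^ k) := by
    have hr : ‖(1 / (q : ℝ))‖ < 1 := by
      rw [Real.norm_of_nonneg (by positivity), div_lt_one hq0]; exact hq1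
    have h1 := summable_pow_mul_geometric_of_norm_lt_one 1 hr
    have h0 := summable_pow_mul_geometric_of_norm_lt_one 0 hr
    refine (h1.add h0).congr fun k => ?_
    simp; ring
  have key : ∀ n : ℕ, (∑ i ∈ IdxSet q n, L (Nat.log q (n / i))) / n
      = ∑' k : ℕ, L k * ((cnt q n k : ℝ) / n) := by
    intro n
    have hz : ∀ k ∉ (IdxSet q n).image (fun i => Nat.log q (n / i)),
        L k * ((cnt q n k : ℝ) / n) = 0 := by
      intro k hk
      have : cnt q n k = 0 := by
        unfold cnt
        rw [Finset.card_eq_zero, Finset.filter_eq_empty_iff]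
        intro i hi h
        exact hk (Finset.mem_image.2 ⟨i, hi, h⟩)
      simp [this]
    rw [tsum_eq_sum hz, Finset.sum_comp L (fun i => Nat.log q (n / i)), Finset.sum_div]
    refine Finset.sum_congr rfl fun k _ => ?_
    unfold cnt
    rw [nsmul_eq_mul]
    ring
  simp_rw [key]
  rw [← tsum_mul_left]
  refine tendsto_tsum_of_dominated_convergence hsum (fun k => ?_) ?_
  · have := (cnt_tendsto (k := k) hq).const_mul (L k)
    convert this using 2
    ring
  · refine Eventually.of_forall fun n k => ?_
    rw [norm_mul, Real.norm_eq_abs, Real.norm_of_nonneg (by positivity)]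
    refine mul_le_mul (hL k) ?_ (by positivity) (by positivity)
    rcases Nat.eq_zero_or_pos n with rfl | hn
    · simp
    · have hn' : (0 : ℝ) < n := by exact_mod_cast hn
      rw [div_le_iff₀ hn']
      refine (cnt_le hq).trans (le_of_eq ?_)
      rw [one_div, inv_pow]
      field_simp

theorem wset_pos {m : ℕ} (k : ℕ) {Ω : Set (ℕ+ → Fin m)} (hne : Ω.Nonempty) :
    0 < (WSet k Ω).ncard :=
  (Set.ncard_pos (Set.toFinite _)).2 (hne.image _)

theorem wset_le {m : ℕ} (k : ℕ) (Ω : Set (ℕ+ → Fin m)) : (WSet k Ω).ncard ≤ m ^ k := by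
  have h := Set.ncard_le_ncard (Set.subset_univ (WSet k Ω)) (Set.toFinite _)
  rw [Set.ncard_univ] at h
  simpa using h

theorem logb_bound {m : ℕ} (hm : 2 ≤ m) (k : ℕ) {Ω : Set (ℕ+ → Fin m)} (hne : Ω.Nonempty) :
    |Real.logb m ((WSet (k + 1) Ω).ncard)| ≤ (k : ℝ) + 1 := by
  have hm1 : (1 : ℝ) < m := by exact_mod_cast (by omega : 1 < m)
  have h1 : (1 : ℝ) ≤ (WSet (k + 1) Ω).ncard := by exact_mod_cast wset_pos (k + 1) hne
  rw [abs_of_nonneg (Real.logb_nonneg hm1 h1), Real.logb_le_iff_le_rpow hm1 (by linarith)]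
  have := wset_le (k + 1) Ω
  rw [show (k : ℝ) + 1 = ((k + 1 : ℕ) : ℝ) by push_cast; rfl, Real.rpow_natCast]
  exact_mod_cast this

/-- **Theorem 2.2 (ii), first part.** The Minkowski dimension of `X_Ω` exists and equals
`(q-1)² Σ_{k≥1} log_m |Pref_k(Ω)| / q^{k+1}`. -/
theorem stmt8 (m : ℕ) (hm : 2 ≤ m) (q : ℕ+) (hq : 2 ≤ (q : ℕ))
    (Ω : Set (ℕ+ → Fin m)) (hne : Ω.Nonempty) (hcl : IsClosed Ω) :
    Tendsto (fun n : ℕ => Real.logb m (NWords n (XOm q Ω)) / n) atTop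
      (𝓝 (((q : ℝ) - 1) ^ 2 *
        ∑' k : ℕ,
          Real.logb m
            (Set.ncard {u : List (Fin m) | u.length = k + 1 ∧ u ∈ Pref Ω}) /
            (q : ℝ) ^ (k + 2))) := by
  simp only [NWords, ncard_words]
  have h := sum_tendsto hq (fun k => Real.logb m ((WSet (k + 1) Ω).ncard))
    (fun k => logb_bound hm k hne)
  refine h.congr fun n => ?_
  rw [card_prod hq Ω hne n]
  push_cast
  rw [Real.logb_prod]
  intro i _
  have := wset_pos (Nat.log q (n / i) + 1) hne
  positivity
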